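/- Well-typedness of the translation of the constant domain axiom: for every instance I = ∀α(A∨B) → ∀α A ∨ B of the constant domain axiom (α not occurring in B), the intuitionistic proof term (D^I)* := λf. f c [z. ι0(λα. f α [x. x, y. d^A]), z. ι1(z)] satisfies IL⊥ ⊢ (D^I)* : I, where c is a fixed constant of the first-order language, f has type ∀α(A∨B), and d^A is a closed term of type A in IL⊥. -/

import Mathlib

/-! A Curry-Howard formalization of the intuitionistic first-order logic of
constant domains CD (Aschieri-Genco style), with de Bruijn indices both for
first-order variables and for proof-term variables. -/

/-- First-order terms: variables (de Bruijn), constants, function applications. -/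
inductive Tm : Type where
  | var : ℕ → Tm
  | const : ℕ → Tm
  | func : ℕ → List Tm → Tm

namespace Tm

/-- Lift (shift by `d`) the first-order variables `≥ c`. -/
def lift (d c : ℕ) : Tm → Tm
  | var i => if i < c then var i else var (i + d)
  | const k => const k
  | func f ts => func f (ts.attach.map fun x => lift d c x.1)
termination_by t => sizeOf t
decreasing_by have := List.sizeOf_lt_of_mem x.2; simp; omega

/-- Substitute the term `m` for the first-order variable `k` (variables `> k` are decremented). -/
def subst (k : ℕ) (m : Tm) : Tm → Tm
  | var i => if i = k then m else if i < k then var i else var (i - 1)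
  | const c' => const c'
  | func f ts => func f (ts.attach.map fun x => subst k m x.1)
termination_by t => sizeOf t
decreasing_by have := List.sizeOf_lt_of_mem x.2; simp; omega

end Tm

/-- First-order formulas, with de Bruijn quantifiers. -/
inductive Fml : Type where
  | atom : ℕ → List Tm → Fml
  | bot : Fml
  | conj : Fml → Fml → Fml
  | disj : Fml → Fml → Fml
  | impl : Fml → Fml → Fml
  | all : Fml → Fml
  | ex : Fml → Fml

namespace Fml

/-- Lift (shift by `d`) the free first-order variables `≥ c`. -/
def lift (d : ℕ) : ℕ → Fml → Fml
  | c, atom P ts => atom P (ts.map (Tm.lift d c))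
  | _, bot => bot
  | c, conj A B => conj (lift d c A) (lift d c B)
  | c, disj A B => disj (lift d c A) (lift d c B)
  | c, impl A B => impl (lift d c A) (lift d c B)
  | c, all A => all (lift d (c + 1) A)
  | c, ex A => ex (lift d (c + 1) A)

/-- Substitute the term `m` for the free first-order variable `k`. -/
def subst : ℕ → Tm → Fml → Fml
  | k, m, atom P ts => atom P (ts.map (Tm.subst k m))
  | _, _, bot => bot
  | k, m, conj A B => conj (subst k m A) (subst k m B)
  | k, m, disj A B => disj (subst k m A) (subst k m B)
  | k, m, impl A B => impl (subst k m A) (subst k m B)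
  | k, m, all A => all (subst (k + 1) (m.lift 1 0) A)
  | k, m, ex A => ex (subst (k + 1) (m.lift 1 0) A)

/-- Atomic formulas (including `⊥`, a 0-ary predicate symbol). -/
def Atomic : Fml → Prop
  | atom _ _ => True
  | bot => True
  | _ => False

end Fml

/-- Proof terms of CD. Proof-term variables are de Bruijn indices; `lam`
binds a proof variable, `qlam` binds a first-order variable, `case` binds one
proof variable in each branch, `edest` binds one first-order variable and one
proof variable in its second argument. `D A B` is the constant for the
constant-domain axiom `∀α(A ∨ B) → ∀α A ∨ B` (in de Bruijn style, `A` may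
contain the bound variable `0` while `B` is a formula of the outer context,
so that "`α` does not occur in `B`" holds by construction). -/
inductive Pf : Type where
  | var : ℕ → Pf
  | pair : Pf → Pf → Pf
  | proj : Bool → Pf → Pf
  | lam : Fml → Pf → Pf
  | app : Pf → Pf → Pf
  | inj : Bool → Pf → Pf
  | case : Pf → Pf → Pf → Pf
  | qlam : Pf → Pf
  | qapp : Pf → Tm → Pf
  | epair : Tm → Pf → Pf
  | edest : Pf → Pf → Pf
  | efq : Fml → Pf → Pf
  | D : Fml → Fml → Pf
  | F : Pf

namespace Pf

/-- Lift the free first-order variables `≥ c` by `d` in a proof term. -/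
def tlift : Pf → ℕ → ℕ → Pf
  | var n, _, _ => var n
  | pair u t, d, c => pair (tlift u d c) (tlift t d c)
  | proj b u, d, c => proj b (tlift u d c)
  | lam A u, d, c => lam (A.lift d c) (tlift u d c)
  | app u t, d, c => app (tlift u d c) (tlift t d c)
  | inj b u, d, c => inj b (tlift u d c)
  | case u w₁ w₂, d, c => case (tlift u d c) (tlift w₁ d c) (tlift w₂ d c)
  | qlam u, d, c => qlam (tlift u d (c + 1))
  | qapp u m, d, c => qapp (tlift u d c) (m.lift d c)
  | epair m u, d, c => epair (m.lift d c) (tlift u d c)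
  | edest u v, d, c => edest (tlift u d c) (tlift v d (c + 1))
  | efq P u, d, c => efq (P.lift d c) (tlift u d c)
  | D A B, d, c => D (A.lift d (c + 1)) (B.lift d c)
  | F, _, _ => F

/-- Lift the free proof-term variables `≥ c` by `d` in a proof term. -/
def plift : Pf → ℕ → ℕ → Pf
  | var n, d, c => if n < c then var n else var (n + d)
  | pair u t, d, c => pair (plift u d c) (plift t d c)
  | proj b u, d, c => proj b (plift u d c)
  | lam A u, d, c => lam A (plift u d (c + 1))
  | app u t, d, c => app (plift u d c) (plift t d c)
  | inj b u, d, c => inj b (plift u d c)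
  | case u w₁ w₂, d, c => case (plift u d c) (plift w₁ d (c + 1)) (plift w₂ d (c + 1))
  | qlam u, d, c => qlam (plift u d c)
  | qapp u m, d, c => qapp (plift u d c) m
  | epair m u, d, c => epair m (plift u d c)
  | edest u v, d, c => edest (plift u d c) (plift v d (c + 1))
  | efq P u, d, c => efq P (plift u d c)
  | D A B, _, _ => D A B
  | F, _, _ => F

/-- Substitute the proof term `q` for the proof variable `k` (variables `> k` decremented). -/
def psubst : Pf → ℕ → Pf → Pf
  | var n, k, q => if n = k then q else if n < k then var n else var (n - 1)
  | pair u t, k, q => pair (psubst u k q) (psubst t k q)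
  | proj b u, k, q => proj b (psubst u k q)
  | lam A u, k, q => lam A (psubst u (k + 1) (plift q 1 0))
  | app u t, k, q => app (psubst u k q) (psubst t k q)
  | inj b u, k, q => inj b (psubst u k q)
  | case u w₁ w₂, k, q =>
      case (psubst u k q) (psubst w₁ (k + 1) (plift q 1 0)) (psubst w₂ (k + 1) (plift q 1 0))
  | qlam u, k, q => qlam (psubst u k (tlift q 1 0))
  | qapp u m, k, q => qapp (psubst u k q) m
  | epair m u, k, q => epair m (psubst u k q)
  | edest u v, k, q => edest (psubst u k q) (psubst v (k + 1) (tlift (plift q 1 0) 1 0))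
  | efq P u, k, q => efq P (psubst u k q)
  | D A B, _, _ => D A B
  | F, _, _ => F

/-- Substitute the first-order term `m` for the first-order variable `k` in a proof term. -/
def tsubst : Pf → ℕ → Tm → Pf
  | var n, _, _ => var n
  | pair u t, k, m => pair (tsubst u k m) (tsubst t k m)
  | proj b u, k, m => proj b (tsubst u k m)
  | lam A u, k, m => lam (A.subst k m) (tsubst u k m)
  | app u t, k, m => app (tsubst u k m) (tsubst t k m)
  | inj b u, k, m => inj b (tsubst u k m)
  | case u w₁ w₂, k, m => case (tsubst u k m) (tsubst w₁ k m) (tsubst w₂ k m)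
  | qlam u, k, m => qlam (tsubst u (k + 1) (m.lift 1 0))
  | qapp u t, k, m => qapp (tsubst u k m) (Tm.subst k m t)
  | epair t u, k, m => epair (Tm.subst k m t) (tsubst u k m)
  | edest u v, k, m => edest (tsubst u k m) (tsubst v (k + 1) (m.lift 1 0))
  | efq P u, k, m => efq (P.subst k m) (tsubst u k m)
  | D A B, k, m => D (A.subst (k + 1) (m.lift 1 0)) (B.subst k m)
  | F, _, _ => F

/-- The set of free proof-term variables of a proof term. -/
def fvars : Pf → Set ℕ
  | var n => {n}
  | pair u t => fvars u ∪ fvars t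
  | proj _ u => fvars u
  | lam _ u => {n | n + 1 ∈ fvars u}
  | app u t => fvars u ∪ fvars t
  | inj _ u => fvars u
  | case u w₁ w₂ => fvars u ∪ {n | n + 1 ∈ fvars w₁} ∪ {n | n + 1 ∈ fvars w₂}
  | qlam u => fvars u
  | qapp u _ => fvars u
  | epair _ u => fvars u
  | edest u v => fvars u ∪ {n | n + 1 ∈ fvars v}
  | efq _ u => fvars u
  | D _ _ => ∅
  | F => ∅

end Pf

/-- The typing relation of the intuitionistic calculus IL⊥: the standard
natural deduction rules plus the constant `F : ⊥`, and (by contrast with CD)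
no rule for the constants `D`. -/
inductive TypedIL : List Fml → Pf → Fml → Prop where
  | var {Γ n A} : Γ[n]? = some A → TypedIL Γ (.var n) A
  | pair {Γ u t A B} : TypedIL Γ u A → TypedIL Γ t B → TypedIL Γ (.pair u t) (.conj A B)
  | projL {Γ u A B} : TypedIL Γ u (.conj A B) → TypedIL Γ (.proj false u) A
  | projR {Γ u A B} : TypedIL Γ u (.conj A B) → TypedIL Γ (.proj true u) B
  | lam {Γ u A B} : TypedIL (A :: Γ) u B → TypedIL Γ (.lam A u) (.impl A B)
  | app {Γ t u A B} : TypedIL Γ t (.impl A B) → TypedIL Γ u A → TypedIL Γ (.app t u) B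
  | injL {Γ u A B} : TypedIL Γ u A → TypedIL Γ (.inj false u) (.disj A B)
  | injR {Γ u A B} : TypedIL Γ u B → TypedIL Γ (.inj true u) (.disj A B)
  | case {Γ u w₁ w₂ A B C} : TypedIL Γ u (.disj A B) → TypedIL (A :: Γ) w₁ C →
      TypedIL (B :: Γ) w₂ C → TypedIL Γ (.case u w₁ w₂) C
  | qlam {Γ u A} : TypedIL (Γ.map (Fml.lift 1 0)) u A → TypedIL Γ (.qlam u) (.all A)
  | qapp {Γ u A} (m : Tm) : TypedIL Γ u (.all A) → TypedIL Γ (.qapp u m) (A.subst 0 m)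
  | epair {Γ u A} (m : Tm) : TypedIL Γ u (A.subst 0 m) → TypedIL Γ (.epair m u) (.ex A)
  | edest {Γ u t A C} : TypedIL Γ u (.ex A) →
      TypedIL (A :: Γ.map (Fml.lift 1 0)) t (C.lift 1 0) → TypedIL Γ (.edest u t) C
  | efq {Γ u P} : TypedIL Γ u .bot → Fml.Atomic P → TypedIL Γ (.efq P u) P
  | F {Γ} : TypedIL Γ .F .bot

/-- The translation of the constant-domain axiom constant `D^I`, for the
instance `I = ∀α(A ∨ B) → ∀α A ∨ B` (`α` not occurring in `B`, which in de
Bruijn style is expressed by the lifting `B.lift 1 0` under the quantifier):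
`(D^I)* = λf. f c [z. ι₀(λα. f α [x. x, y. d^A]), z. ι₁(z)]`,
where `c = Tm.const 0` is the fixed constant of the language and `dA` is the
dummy closed proof term `d^A` of type `A`. -/
def transD (A B : Fml) (dA : Pf) : Pf :=
  .lam (.all (.disj A (B.lift 1 0)))
    (.case (.qapp (.var 0) (Tm.const 0))
      (.inj false (.qlam (.case (.qapp (.var 1) (Tm.var 0)) (.var 0) dA)))
      (.inj true (.var 0)))

/-- Substituting for a variable that was just introduced by lifting has no effect. -/
theorem Tm.subst_lift (k : ℕ) (m : Tm) : ∀ t : Tm, Tm.subst k m (t.lift 1 k) = t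
  | .var i => by
    rw [Tm.lift]
    split_ifs with h
    · rw [Tm.subst, if_neg h.ne, if_pos h]
    · rw [Tm.subst, if_neg (by omega), if_neg (by omega), Nat.add_sub_cancel]
  | .const _ => by simp only [Tm.lift, Tm.subst]
  | .func f ts => by
    have h : ∀ x ∈ ts, Tm.subst k m (x.lift 1 k) = x := fun x _ => Tm.subst_lift k m x
    simp only [Tm.lift, Tm.subst, List.map_subtype, List.unattach_attach, List.map_map]
    rw [List.map_congr_left (f := _ ∘ _) (g := id) h, List.map_id]

/-- Instantiating the variable `k` by itself undoes a lifting above `k`. -/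
theorem Tm.subst_var_lift_succ (k : ℕ) : ∀ t : Tm, Tm.subst k (.var k) (t.lift 1 (k + 1)) = t
  | .var i => by
    rw [Tm.lift]
    split_ifs with h
    · rw [Tm.subst]
      split_ifs with h₁ h₂
      · rw [h₁]
      · rfl
      · omega
    · rw [Tm.subst, if_neg (by omega), if_neg (by omega), Nat.add_sub_cancel]
  | .const _ => by simp only [Tm.lift, Tm.subst]
  | .func f ts => by
    have h : ∀ x ∈ ts, Tm.subst k (.var k) (x.lift 1 (k + 1)) = x :=
      fun x _ => Tm.subst_var_lift_succ k x
    simp only [Tm.lift, Tm.subst, List.map_subtype, List.unattach_attach, List.map_map]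
    rw [List.map_congr_left (f := _ ∘ _) (g := id) h, List.map_id]

/-- Substituting for a variable that was just introduced by lifting has no effect. -/
theorem Fml.subst_lift (A : Fml) (k : ℕ) (m : Tm) : (A.lift 1 k).subst k m = A := by
  induction A generalizing k m with
  | atom P ts =>
    simp only [Fml.lift, Fml.subst, List.map_map, Function.comp_def, Tm.subst_lift, List.map_id']
  | _ => simp_all only [Fml.lift, Fml.subst]

/-- Instantiating the variable `k` by itself undoes a lifting above `k`. -/
theorem Fml.subst_var_lift_succ (A : Fml) (k : ℕ) :
    (A.lift 1 (k + 1)).subst k (.var k) = A := by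
  have h (k : ℕ) : (Tm.var k).lift 1 0 = .var (k + 1) := by
    rw [Tm.lift, if_neg k.not_lt_zero]
  induction A generalizing k with
  | atom P ts =>
    simp only [Fml.lift, Fml.subst, List.map_map, Function.comp_def, Tm.subst_var_lift_succ,
      List.map_id']
  | _ => simp_all only [Fml.lift, Fml.subst]

/-- Weakening by assumptions at the outer end of the context. -/
theorem TypedIL.append {Γ : List Fml} {t : Pf} {A : Fml} (h : TypedIL Γ t A) (Δ : List Fml) :
    TypedIL (Γ ++ Δ) t A := by
  induction h generalizing Δ with
  | var h =>
    obtain ⟨hn, -⟩ := List.getElem?_eq_some_iff.1 h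
    exact .var (by rw [List.getElem?_append_left hn, h])
  | pair _ _ ih₁ ih₂ => exact .pair (ih₁ Δ) (ih₂ Δ)
  | projL _ ih => exact .projL (ih Δ)
  | projR _ ih => exact .projR (ih Δ)
  | lam _ ih => exact .lam (ih Δ)
  | app _ _ ih₁ ih₂ => exact .app (ih₁ Δ) (ih₂ Δ)
  | injL _ ih => exact .injL (ih Δ)
  | injR _ ih => exact .injR (ih Δ)
  | case _ _ _ ih ih₁ ih₂ => exact .case (ih Δ) (ih₁ Δ) (ih₂ Δ)
  | qlam _ ih => exact .qlam (by simpa only [List.map_append] using ih (Δ.map (Fml.lift 1 0)))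
  | qapp m _ ih => exact .qapp m (ih Δ)
  | epair m _ ih => exact .epair m (ih Δ)
  | edest _ _ ih₁ ih₂ =>
    exact .edest (ih₁ Δ)
      (by simpa only [List.map_append, List.cons_append] using ih₂ (Δ.map (Fml.lift 1 0)))
  | efq _ hP ih => exact .efq (ih Δ) hP
  | F => exact .F

/-- **Well-typedness of the translation of the constant domain axiom**: for
every instance `I = ∀α(A ∨ B) → ∀α A ∨ B` of the constant domain axiom and
every closed proof term `d^A` of type `A` in IL⊥, we have
`IL⊥ ⊢ (D^I)* : I`. -/
theorem transD_typed (A B : Fml) (dA : Pf) (hdA : TypedIL [] dA A) :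
    TypedIL [] (transD A B dA)
      (.impl (.all (.disj A (B.lift 1 0))) (.disj (.all A) B)) := by
  have hc : TypedIL [.all (.disj A (B.lift 1 0))] (.qapp (.var 0) (Tm.const 0))
      (.disj (A.subst 0 (Tm.const 0)) B) := by
    simpa only [Fml.subst, Fml.subst_lift] using
      TypedIL.qapp (Tm.const 0) (.var (n := 0) (Γ := [.all (.disj A (B.lift 1 0))]) rfl)
  have hα (C : Fml) : TypedIL [C, .all ((Fml.disj A (B.lift 1 0)).lift 1 1)]
      (.qapp (.var 1) (Tm.var 0)) (.disj A (B.lift 1 0)) := by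
    simpa only [Fml.subst_var_lift_succ] using
      TypedIL.qapp (Tm.var 0)
        (.var (n := 1) (Γ := [C, .all ((Fml.disj A (B.lift 1 0)).lift 1 1)]) rfl)
  exact .lam (.case hc
    (.injL (.qlam (.case (hα _) (.var rfl) (hdA.append _))))
    (.injR (.var rfl)))
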